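/- (Chistyakov's first fixed point theorem) Let w be a strict convex metric modular on a set X, let x₀ ∈ X, and suppose the modular set X_w^*(x₀) is w-complete. Let T : X_w^*(x₀) → X_w^*(x₀) be a modular contractive mapping (with constants k ∈ (0,1) and λ₀ > 0) such that for each λ > 0 there exists x = x(λ) ∈ X_w^*(x₀) with w_λ(x, Tx) < ∞. Then T has a fixed point x* in X_w^*(x₀). If moreover w takes only finite values on X_w^*(x₀) × X_w^*(x₀), then the fixed point x* is unique and for each initial point y₀ ∈ X_w^*(x₀) the sequence of iterates (Tⁿ y₀) is modular convergent to x*. -/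

import Mathlib

open ENNReal Filter Topology

/-- Monotonicity of `l ↦ l * w l x y` for a convex modular, in the form `w l ≤ k * w (k * l)`. -/
theorem convex_modular_le_mul {X : Type*} {w : ℝ → X → X → ℝ≥0∞}
    (h1 : ∀ x y : X, (∀ l : ℝ, 0 < l → w l x y = 0) ↔ x = y)
    (h3 : ∀ l m : ℝ, 0 < l → 0 < m → ∀ x y z : X,
      w (l + m) x y ≤ ENNReal.ofReal (l / (l + m)) * w l x z
        + ENNReal.ofReal (m / (l + m)) * w m z y)
    {k l : ℝ} (hk0 : 0 < k) (hk1 : k < 1) (hl : 0 < l) (x y : X) :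
    w l x y ≤ ENNReal.ofReal k * w (k * l) x y := by
  have hm : 0 < (1 - k) * l := mul_pos (by linarith) hl
  have h := h3 (k * l) ((1 - k) * l) (mul_pos hk0 hl) hm x y y
  have e : k * l + (1 - k) * l = l := by ring
  rwa [e, (h1 y y).2 rfl _ hm, mul_zero, add_zero, mul_div_cancel_right₀ _ hl.ne'] at h

/-- A map contracting `w l` by the factor `k` on an invariant set has iterates contracting `w l`
by the factor `k ^ n`. -/
theorem modular_iterate_le {X : Type*} {f : X → X → ℝ≥0∞} {S : Set X} {T : X → X} {c : ℝ≥0∞}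
    (hTS : ∀ x ∈ S, T x ∈ S) (hT : ∀ x ∈ S, ∀ y ∈ S, f (T x) (T y) ≤ c * f x y)
    (n : ℕ) {x y : X} (hx : x ∈ S) (hy : y ∈ S) :
    f (T^[n] x) (T^[n] y) ≤ c ^ n * f x y := by
  induction n generalizing x y with
  | zero => simp
  | succ n ih =>
    rw [Function.iterate_succ_apply, Function.iterate_succ_apply, pow_succ, mul_assoc]
    exact (ih (hTS x hx) (hTS y hy)).trans (by gcongr; exact hT x hx y hy)

/-- Chistyakov's first fixed point theorem: let `w` be a strict
convex metric modular on `X`, with `X_w^*(x₀)` `w`-complete, and let `T` be a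
`w`-contraction on `X_w^*(x₀)` such that for each `l > 0` some `x ∈ X_w^*(x₀)`
has `w l x (T x) < ∞`.  Then `T` has a fixed point in `X_w^*(x₀)`; if moreover
`w` is finite-valued on `X_w^*(x₀)`, the fixed point is unique and every orbit
is modular convergent to it. -/
theorem chistyakov_first_fixed_point {X : Type*} (w : ℝ → X → X → ℝ≥0∞)
    (h1 : ∀ x y : X, (∀ l : ℝ, 0 < l → w l x y = 0) ↔ x = y)
    (h2 : ∀ l : ℝ, 0 < l → ∀ x y : X, w l x y = w l y x)
    (h3 : ∀ l m : ℝ, 0 < l → 0 < m → ∀ x y z : X,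
      w (l + m) x y ≤ ENNReal.ofReal (l / (l + m)) * w l x z
        + ENNReal.ofReal (m / (l + m)) * w m z y)
    (hstrict : ∀ x y : X, x ≠ y → ∀ l : ℝ, 0 < l → 0 < w l x y)
    (x₀ : X)
    (S : Set X) (hS : S = {x : X | ∃ l : ℝ, 0 < l ∧ w l x x₀ < ⊤})
    (hcomplete : ∀ u : ℕ → X, (∀ n, u n ∈ S) → ∀ l : ℝ, 0 < l →
      Tendsto (fun p : ℕ × ℕ => w l (u p.1) (u p.2)) atTop (𝓝 0) →
      ∃ x ∈ S, Tendsto (fun n => w l (u n) x) atTop (𝓝 0))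
    (T : X → X) (hTS : ∀ x ∈ S, T x ∈ S)
    (k lam0 : ℝ) (hk0 : 0 < k) (hk1 : k < 1) (hlam0 : 0 < lam0)
    (hT : ∀ l : ℝ, 0 < l → l ≤ lam0 → ∀ x ∈ S, ∀ y ∈ S,
      w (k * l) (T x) (T y) ≤ w l x y)
    (hfin : ∀ l : ℝ, 0 < l → ∃ x ∈ S, w l x (T x) < ⊤) :
    (∃ xs ∈ S, T xs = xs) ∧
    ((∀ l : ℝ, 0 < l → ∀ x ∈ S, ∀ y ∈ S, w l x y < ⊤) →
      ∃ xs, xs ∈ S ∧ T xs = xs ∧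
        (∀ y ∈ S, T y = y → y = xs) ∧
        (∀ y₀ ∈ S, ∃ l : ℝ, 0 < l ∧
          Tendsto (fun n => w l (T^[n] y₀) xs) atTop (𝓝 0))) := by
  have hl1 : 0 < (1 - k) * lam0 := mul_pos (by linarith) hlam0
  have hkl : 0 < k * lam0 := mul_pos hk0 hlam0
  have hcontr : ∀ x ∈ S, ∀ y ∈ S, w lam0 (T x) (T y) ≤ ENNReal.ofReal k * w lam0 x y := by
    intro x hx y hy
    refine (convex_modular_le_mul h1 h3 hk0 hk1 hlam0 _ _).trans ?_
    gcongr
    exact hT lam0 hlam0 le_rfl x hx y hy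
  have hiter : ∀ (n : ℕ), ∀ x ∈ S, T^[n] x ∈ S := by
    intro n
    induction n with
    | zero => exact fun x hx => hx
    | succ n ih => exact fun x hx => ih _ (hTS x hx)
  have hpow : ∀ C : ℝ≥0∞, C ≠ ⊤ →
      Tendsto (fun n : ℕ => ENNReal.ofReal k ^ n * C) atTop (𝓝 0) := by
    intro C hC
    have hk : ENNReal.ofReal k < 1 := by simpa using hk1
    simpa using ENNReal.Tendsto.mul_const (tendsto_pow_atTop_nhds_zero_of_lt_one hk)
      (Or.inr hC)
  have hex : ∃ xs ∈ S, T xs = xs := by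
    obtain ⟨x, hx, hC⟩ := hfin _ hl1
    set C := w ((1 - k) * lam0) x (T x)
    have horbit : ∀ j : ℕ, w lam0 x (T^[j] x) ≤ C := by
      intro j
      induction j with
      | zero => simp [(h1 x x).2 rfl lam0 hlam0]
      | succ j ih =>
        have h := h3 _ _ hl1 hkl x (T^[j + 1] x) (T x)
        have e : (1 - k) * lam0 + k * lam0 = lam0 := by ring
        rw [e, mul_div_cancel_right₀ _ hlam0.ne', mul_div_cancel_right₀ _ hlam0.ne',
          Function.iterate_succ_apply'] at h
        rw [Function.iterate_succ_apply']
        calc w lam0 x (T (T^[j] x))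
            ≤ ENNReal.ofReal (1 - k) * C
              + ENNReal.ofReal k * w (k * lam0) (T x) (T (T^[j] x)) := h
          _ ≤ ENNReal.ofReal (1 - k) * C + ENNReal.ofReal k * C := by
              gcongr
              exact (hT lam0 hlam0 le_rfl x hx _ (hiter j x hx)).trans ih
          _ = C := by
              rw [← add_mul, ← ENNReal.ofReal_add (by linarith) hk0.le]
              simp
    have htail : ∀ m n : ℕ, m ≤ n →
        w lam0 (T^[m] x) (T^[n] x) ≤ ENNReal.ofReal k ^ m * C := by
      intro m n hmn
      obtain ⟨j, rfl⟩ := Nat.exists_eq_add_of_le hmn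
      rw [Function.iterate_add_apply]
      refine (modular_iterate_le hTS hcontr m hx (hiter j x hx)).trans ?_
      gcongr
      exact horbit j
    have hcauchy : Tendsto (fun p : ℕ × ℕ => w lam0 (T^[p.1] x) (T^[p.2] x)) atTop (𝓝 0) := by
      have hfst : Tendsto (fun p : ℕ × ℕ => ENNReal.ofReal k ^ p.1 * C) atTop (𝓝 0) := by
        rw [← prod_atTop_atTop_eq]
        exact (hpow C hC.ne).comp tendsto_fst
      have hsnd : Tendsto (fun p : ℕ × ℕ => ENNReal.ofReal k ^ p.2 * C) atTop (𝓝 0) := by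
        rw [← prod_atTop_atTop_eq]
        exact (hpow C hC.ne).comp tendsto_snd
      have hsum := hfst.add hsnd
      rw [add_zero] at hsum
      refine tendsto_of_tendsto_of_tendsto_of_le_of_le tendsto_const_nhds hsum
        (fun _ => zero_le) fun p => ?_
      rcases le_total p.1 p.2 with h | h
      · exact (htail _ _ h).trans le_self_add
      · simp only [h2 lam0 hlam0 (T^[p.1] x)]
        exact (htail _ _ h).trans le_add_self
    obtain ⟨xs, hxs, hlim⟩ := hcomplete (fun n => T^[n] x) (fun n => hiter n x hx) lam0 hlam0
      hcauchy
    refine ⟨xs, hxs, ?_⟩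
    by_contra hne
    have hbound : ∀ n : ℕ, w (lam0 + k * lam0) xs (T xs)
        ≤ w lam0 (T^[n + 1] x) xs + w lam0 (T^[n] x) xs := by
      intro n
      have hle : ∀ t : ℝ, t ≤ 1 → ∀ a : ℝ≥0∞, ENNReal.ofReal t * a ≤ a := fun t ht a =>
        mul_le_of_le_one_left' (ENNReal.ofReal_le_one.2 ht)
      refine (h3 lam0 (k * lam0) hlam0 hkl xs (T xs) (T^[n + 1] x)).trans (add_le_add ?_ ?_)
      · rw [h2 lam0 hlam0 (T^[n + 1] x)]
        exact hle _ (div_le_one_of_le₀ (by linarith) (by linarith)) _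
      · refine (hle _ (div_le_one_of_le₀ (by linarith) (by linarith)) _).trans ?_
        rw [Function.iterate_succ_apply']
        exact hT lam0 hlam0 le_rfl _ (hiter n x hx) xs hxs
    have hzero := ((tendsto_add_atTop_iff_nat 1).2 hlim).add hlim
    rw [add_zero] at hzero
    exact absurd (ge_of_tendsto' hzero hbound)
      (not_le.2 (hstrict xs (T xs) (Ne.symm hne) _ (by linarith)))
  refine ⟨hex, fun hfinite => ?_⟩
  obtain ⟨xs, hxs, hfix⟩ := hex
  have horb : ∀ y ∈ S, Tendsto (fun n => w lam0 (T^[n] y) xs) atTop (𝓝 0) := by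
    intro y hy
    refine tendsto_of_tendsto_of_tendsto_of_le_of_le tendsto_const_nhds
      (hpow _ (hfinite lam0 hlam0 y hy xs hxs).ne) (fun _ => zero_le) fun n => ?_
    simpa only [Function.iterate_fixed hfix] using modular_iterate_le hTS hcontr n hy hxs
  refine ⟨xs, hxs, hfix, fun y hy hyfix => ?_, fun y hy => ⟨lam0, hlam0, horb y hy⟩⟩
  by_contra hne
  have h := horb y hy
  simp only [Function.iterate_fixed hyfix] at h
  exact (hstrict y xs hne lam0 hlam0).ne' (tendsto_nhds_unique tendsto_const_nhds h)
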